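/- Let X be a Banach two-sided ℍ-module, let D(A) be a right ℍ-submodule of X, and let A : D(A) → X be a closed right linear operator such that ρ_S(A) ∩ ℝ ≠ ∅. Let q0 ∈ ρ_S(A) and set R := ‖Q_{q0}(A)‖^{−1/2}. Then for every q ∈ U(q0,R) (which is contained in ρ_S(A)), the series Σ_{n=0}^∞ (−1)^{n+1} B_{n+1} ∂_S p_{q0,n}(q) converges in Lin^r(X) and its sum equals Q_q(A). -/

import Mathlib

open MulOpposite Filter Topology Classical

noncomputable section

notation "ℍ" => Quaternion ℝ

/-- A *Banach two-sided `ℍ`-module*: a two-sided `ℍ`-module (left `ℍ`-action, right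
`ℍ`-action encoded as a left `ℍᵐᵒᵖ`-action) whose complete norm satisfies
`‖qx‖ = ‖xq‖ = |q|‖x‖`, and where real scalars act the same on both sides. -/
class QuatBimodule (Y : Type*) [NormedAddCommGroup Y]
    [Module ℍ Y] [Module ℍᵐᵒᵖ Y] : Prop where
  smul_op_comm : ∀ (p q : ℍ) (y : Y), p • (op q • y) = op q • (p • y)
  norm_smul_left : ∀ (q : ℍ) (y : Y), ‖q • y‖ = ‖q‖ * ‖y‖
  norm_smul_right : ∀ (q : ℍ) (y : Y), ‖op q • y‖ = ‖q‖ * ‖y‖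
  real_smul_comm : ∀ (r : ℝ) (y : Y), ((r : ℝ) : ℍ) • y = op ((r : ℝ) : ℍ) • y

variable {X : Type*} [NormedAddCommGroup X] [Module ℍ X] [Module ℍᵐᵒᵖ X]

/-- Membership in `Lin^r(X)`: additive, right `ℍ`-linear, with finite operator
norm (i.e. `‖B x‖` is bounded on the closed unit ball). -/
def MemLinR (B : X → X) : Prop :=
  (∀ x y : X, B (x + y) = B x + B y) ∧
  (∀ (q : ℍ) (x : X), B (op q • x) = op q • B x) ∧
  BddAbove ((fun x : X => ‖B x‖) '' {x : X | ‖x‖ ≤ 1})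

/-- The operator norm `‖B‖ = sup {‖B x‖ : ‖x‖ ≤ 1}`. -/
def opNorm (B : X → X) : ℝ :=
  sSup ((fun x : X => ‖B x‖) '' {x : X | ‖x‖ ≤ 1})

/-- A right linear operator `A : D(A) → X`, where `D(A)` is a right `ℍ`-submodule
of `X`.  It is encoded as a function `X → X` together with its domain; only the
values on the domain are relevant. -/
structure RightLinearOp (X : Type*) [NormedAddCommGroup X]
    [Module ℍ X] [Module ℍᵐᵒᵖ X] where
  dom : Set X
  toFun : X → X
  zero_mem : (0 : X) ∈ dom
  add_mem : ∀ ⦃x⦄, x ∈ dom → ∀ ⦃y⦄, y ∈ dom → x + y ∈ dom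
  neg_mem : ∀ ⦃x⦄, x ∈ dom → -x ∈ dom
  smulR_mem : ∀ (q : ℍ) ⦃x⦄, x ∈ dom → op q • x ∈ dom
  map_add' : ∀ ⦃x⦄, x ∈ dom → ∀ ⦃y⦄, y ∈ dom → toFun (x + y) = toFun x + toFun y
  map_smulR' : ∀ (q : ℍ) ⦃x⦄, x ∈ dom → toFun (op q • x) = op q • toFun x

namespace RightLinearOp

variable (T : RightLinearOp X)

/-- `A` is closed: its graph is closed in `X × X`. -/
def IsClosedOp : Prop := IsClosed {p : X × X | p.1 ∈ T.dom ∧ T.toFun p.1 = p.2}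

/-- The domain `D(A²)` of `A²`. -/
def dom2 : Set X := {x | x ∈ T.dom ∧ T.toFun x ∈ T.dom}

/-- The operator `Δ_q(A) = A² − 2 Re(q) A + |q|² Id`, with domain `D(A²)`. -/
def delta (q : ℍ) (x : X) : X :=
  T.toFun (T.toFun x) - ((2 * q.re : ℝ) : ℍ) • T.toFun x + ((‖q‖ ^ 2 : ℝ) : ℍ) • x

/-- `B` is the inverse of `Δ_q(A) : D(A²) → X`, and `B ∈ Lin^r(X)`. -/
def IsQInv (q : ℍ) (B : X → X) : Prop :=
  MemLinR B ∧ (∀ x : X, B x ∈ T.dom2) ∧ (∀ x : X, T.delta q (B x) = x) ∧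
    ∀ x ∈ T.dom2, B (T.delta q x) = x

/-- The S-resolvent set `ρ_S(A)`. -/
def rhoS : Set ℍ := {q | ∃ B : X → X, T.IsQInv q B}

/-- `Q_q(A) = Δ_q(A)⁻¹ ∈ Lin^r(X)`, for `q ∈ ρ_S(A)` (junk value otherwise). -/
def qres (q : ℍ) : X → X :=
  if h : q ∈ T.rhoS then h.choose else fun _ => 0

/-- The (left) S-resolvent operator `S_q⁻¹(A) = Q_q(A) q̄ − A Q_q(A)`, where the
right scalar multiple of an operator is `(B q̄)(x) = B(q̄ x)`. -/
def sres (q : ℍ) : X → X :=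
  fun x => T.qres q (star q • x) - T.toFun (T.qres q x)

/-- The coefficients `B_n`: `B_{2k} = Q_{q0}(A)^k`, `B_{2k+1} = Q_{q0}(A)^k S_{q0}⁻¹(A)`. -/
def Bop (q0 : ℍ) (n : ℕ) : X → X :=
  if n % 2 = 0 then (T.qres q0)^[n / 2] else (T.qres q0)^[n / 2] ∘ T.sres q0

end RightLinearOp

/-- The quaternionic polynomial `Δ_q(p) = p² − 2 Re(q) p + |q|²`. -/
def deltaPoly (q p : ℍ) : ℍ :=
  p ^ 2 - ((2 * q.re : ℝ) : ℍ) * p + ((‖q‖ ^ 2 : ℝ) : ℍ)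

/-- The "powers" `p_{q0,n}`: `p_{q0,2k}(q) = Δ_{q0}(q)^k`,
`p_{q0,2k+1}(q) = (q − q0) Δ_{q0}(q)^k`. -/
def spow (q0 : ℍ) (n : ℕ) (q : ℍ) : ℍ :=
  if n % 2 = 0 then deltaPoly q0 q ^ (n / 2) else (q - q0) * deltaPoly q0 q ^ (n / 2)

/-- The Cassini pseudo-metric `u(p,q) = √|Δ_q(p)|`. -/
def cassini (p q : ℍ) : ℝ := Real.sqrt ‖deltaPoly q p‖

/-- The Cassini ball `U(q0,R)`. -/
def cassiniBall (q0 : ℍ) (R : ℝ) : Set ℍ := {p : ℍ | cassini p q0 < R}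

/-- The Cassini topology on `ℍ`: the topology induced by the Cassini pseudo-metric,
i.e. the topology generated by the Cassini balls. -/
def cassiniTopology : TopologicalSpace ℍ :=
  TopologicalSpace.generateFrom {U : Set ℍ | ∃ q0 R, 0 < R ∧ U = cassiniBall q0 R}

/-- The spherical derivative of a function `g : ℍ → ℍ`. -/
def sderivQ (g : ℍ → ℍ) (q : ℍ) : ℍ :=
  if q.im = 0 then deriv (fun t : ℝ => g ((t : ℝ) : ℍ)) q.re
  else (g q - g (star q)) * (q - star q)⁻¹

end

section Coefficients

/-- The pair `(α_k, β_k)` of real numbers with `α_k = ∂_S (q z^k)` and `β_k = ∂_S (z^k)`, where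
`z = d q + e` and `q` has real part `t / 2` and squared norm `n`. -/
noncomputable def sphCoeff (t n d e : ℝ) : ℕ → ℝ × ℝ
  | 0 => (1, 0)
  | k + 1 => ((d * t + e) * (sphCoeff t n d e k).1 - d * n * (sphCoeff t n d e k).2,
      d * (sphCoeff t n d e k).1 + e * (sphCoeff t n d e k).2)

/-- The coefficients `sphCoeff` attached to `z = Δ_{q0}(q)`. -/
noncomputable def cassiniCoeff (q0 q : ℍ) : ℕ → ℝ × ℝ :=
  sphCoeff (2 * q.re) (‖q‖ ^ 2) (2 * q.re - 2 * q0.re) (‖q0‖ ^ 2 - ‖q‖ ^ 2)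

lemma quaternion_norm_sq (q : ℍ) :
    ‖q‖ ^ 2 = q.re ^ 2 + q.imI ^ 2 + q.imJ ^ 2 + q.imK ^ 2 := by
  rw [sq, ← Quaternion.normSq_eq_norm_mul_self, Quaternion.normSq_def']

lemma deltaPoly_eq (q0 q : ℍ) :
    deltaPoly q0 q = ((2 * q.re - 2 * q0.re : ℝ) : ℍ) * q + ((‖q0‖ ^ 2 - ‖q‖ ^ 2 : ℝ) : ℍ) := by
  unfold deltaPoly
  rw [quaternion_norm_sq q, sq q]
  ext <;> simp [-Quaternion.coe_add, -Quaternion.coe_sub, -Quaternion.coe_mul,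
    -Quaternion.coe_pow, sub_mul] <;> ring

lemma deltaPoly_star (q0 q : ℍ) : deltaPoly q0 (star q) = star (deltaPoly q0 q) := by
  rw [deltaPoly_eq, deltaPoly_eq]
  ext <;> simp [-Quaternion.coe_sub, mul_comm]

lemma deltaPoly_pow (q0 q : ℍ) (k : ℕ) :
    deltaPoly q0 q ^ k =
      ((cassiniCoeff q0 q k).1 : ℍ) - star q * ((cassiniCoeff q0 q k).2 : ℍ) := by
  induction k with
  | zero => simp [cassiniCoeff, sphCoeff]
  | succ k ih =>
    rw [pow_succ, ih, deltaPoly_eq]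
    simp only [cassiniCoeff, sphCoeff]
    generalize sphCoeff _ _ _ _ k = c
    rw [quaternion_norm_sq q]
    ext <;> simp [-Quaternion.coe_add, -Quaternion.coe_sub, -Quaternion.coe_mul,
      -Quaternion.coe_pow] <;> ring

lemma cassiniCoeff_snd_succ (q0 q : ℍ) (k : ℕ) :
    ((cassiniCoeff q0 q (k + 1)).2 : ℍ) =
      ((2 * q.re - 2 * q0.re : ℝ) : ℍ) * deltaPoly q0 q ^ k +
        star (deltaPoly q0 q) * ((cassiniCoeff q0 q k).2 : ℍ) := by
  rw [deltaPoly_pow, deltaPoly_eq]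
  simp only [cassiniCoeff, sphCoeff]
  ext <;> simp <;> ring

lemma abs_cassiniCoeff_snd_succ_le (q0 q : ℍ) (k : ℕ) :
    |(cassiniCoeff q0 q (k + 1)).2| ≤
      |2 * q.re - 2 * q0.re| * ((k + 1) * ‖deltaPoly q0 q‖ ^ k) := by
  have key (k : ℕ) : |(cassiniCoeff q0 q (k + 1)).2| ≤
      |2 * q.re - 2 * q0.re| * ‖deltaPoly q0 q‖ ^ k +
        ‖deltaPoly q0 q‖ * |(cassiniCoeff q0 q k).2| := by
    have := norm_add_le (((2 * q.re - 2 * q0.re : ℝ) : ℍ) * deltaPoly q0 q ^ k)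
      (star (deltaPoly q0 q) * ((cassiniCoeff q0 q k).2 : ℍ))
    rw [← cassiniCoeff_snd_succ] at this
    simpa only [norm_mul, norm_pow, norm_star, Quaternion.norm_coe, Real.norm_eq_abs] using this
  induction k with
  | zero => simp [cassiniCoeff, sphCoeff]
  | succ k ih =>
    calc _ ≤ _ := key (k + 1)
      _ ≤ |2 * q.re - 2 * q0.re| * ‖deltaPoly q0 q‖ ^ (k + 1) + ‖deltaPoly q0 q‖ *
          (|2 * q.re - 2 * q0.re| * ((k + 1) * ‖deltaPoly q0 q‖ ^ k)) := by gcongr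
      _ = _ := by push_cast; ring

lemma abs_cassiniCoeff_fst_le (q0 q : ℍ) (k : ℕ) :
    |(cassiniCoeff q0 q k).1| ≤ ‖deltaPoly q0 q‖ ^ k + ‖q‖ * |(cassiniCoeff q0 q k).2| := by
  have := norm_add_le (deltaPoly q0 q ^ k) (star q * ((cassiniCoeff q0 q k).2 : ℍ))
  rw [deltaPoly_pow q0 q, sub_add_cancel, ← deltaPoly_pow] at this
  simpa only [norm_mul, norm_pow, norm_star, Quaternion.norm_coe, Real.norm_eq_abs] using this

lemma summable_cassiniCoeff_snd_succ (q0 q : ℍ) {r : ℝ} (hr : 0 ≤ r)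
    (h : ‖deltaPoly q0 q‖ * r < 1) :
    Summable fun k => |(cassiniCoeff q0 q (k + 1)).2| * r ^ k := by
  have hs : Summable fun k : ℕ => ((k : ℝ) + 1) * (‖deltaPoly q0 q‖ * r) ^ k := by
    have h' : ‖‖deltaPoly q0 q‖ * r‖ < 1 := by
      rwa [Real.norm_of_nonneg (by positivity)]
    have h1 := summable_pow_mul_geometric_of_norm_lt_one 1 h'
    have h0 := summable_geometric_of_norm_lt_one h'
    simpa [add_mul] using h1.add h0
  refine Summable.of_nonneg_of_le (fun k => by positivity) (fun k => ?_)
    (hs.mul_left |2 * q.re - 2 * q0.re|)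
  calc _ ≤ |2 * q.re - 2 * q0.re| * ((k + 1) * ‖deltaPoly q0 q‖ ^ k) * r ^ k := by
        gcongr
        exact abs_cassiniCoeff_snd_succ_le q0 q k
    _ = _ := by ring

lemma summable_cassiniCoeff_fst_succ (q0 q : ℍ) {r : ℝ} (hr : 0 ≤ r)
    (h : ‖deltaPoly q0 q‖ * r < 1) :
    Summable fun k => |(cassiniCoeff q0 q (k + 1)).1| * r ^ k := by
  refine Summable.of_nonneg_of_le (fun k => by positivity) (fun k => ?_)
    (((summable_geometric_of_lt_one (by positivity) h).mul_left ‖deltaPoly q0 q‖).add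
      ((summable_cassiniCoeff_snd_succ q0 q hr h).mul_left ‖q‖))
  calc _ ≤ (‖deltaPoly q0 q‖ ^ (k + 1) + ‖q‖ * |(cassiniCoeff q0 q (k + 1)).2|) * r ^ k := by
        gcongr
        exact abs_cassiniCoeff_fst_le q0 q (k + 1)
    _ = _ := by ring

lemma Summable.mul_pow_of_succ {c : ℕ → ℝ} {r : ℝ} (h : Summable fun k => c (k + 1) * r ^ k) :
    Summable fun k => c k * r ^ k := by
  rw [← summable_nat_add_iff 1]
  exact (h.mul_right r).congr fun k => by ring

lemma sderivQ_of_im_ne_zero (g : ℍ → ℍ) {q c : ℍ} (hq : q.im ≠ 0)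
    (h : g q - g (star q) = c * (q - star q)) : sderivQ g q = c := by
  have hne : q - star q ≠ 0 := by
    intro h0
    rw [Quaternion.star_eq_self.mp (sub_eq_zero.mp h0).symm, Quaternion.im_coe] at hq
    exact hq rfl
  rw [sderivQ, if_neg hq, h, mul_assoc, mul_inv_cancel₀ hne, mul_one]

lemma hasDerivAt_quaternion_coe (r : ℝ) : HasDerivAt (fun t : ℝ => (t : ℍ)) 1 r := by
  have := (hasDerivAt_id r).smul_const (1 : ℍ)
  simpa [← Quaternion.coe_mul_eq_smul] using this

lemma hasDerivAt_deltaPoly_pow (q0 q : ℍ) (hq : q.im = 0) (k : ℕ) :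
    HasDerivAt (fun t : ℝ => deltaPoly q0 (t : ℍ) ^ k) ((cassiniCoeff q0 q k).2 : ℍ) q.re := by
  have hqr : ((q.re : ℝ) : ℍ) = q := by
    conv_rhs => rw [← Quaternion.re_add_im q, hq, add_zero]
  have hstar : star q = q := by rw [← hqr, Quaternion.star_coe]
  induction k with
  | zero => simp [cassiniCoeff, sphCoeff, hasDerivAt_const]
  | succ k ih =>
    have hd : HasDerivAt (fun t : ℝ => deltaPoly q0 (t : ℍ))
        ((2 * q.re - 2 * q0.re : ℝ) : ℍ) q.re := by
      have h := ((hasDerivAt_quaternion_coe q.re).mul (hasDerivAt_quaternion_coe q.re)).sub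
        ((hasDerivAt_quaternion_coe q.re).const_mul ((2 * q0.re : ℝ) : ℍ))
      simp only [deltaPoly, sq (_ : ℍ)]
      refine (h.add_const ((‖q0‖ ^ 2 : ℝ) : ℍ)).congr_deriv ?_
      ext <;> simp [-Quaternion.coe_add, -Quaternion.coe_sub, -Quaternion.coe_mul,
        -Quaternion.coe_pow]
      ring
    have h := hd.mul ih
    simp only [pow_succ']
    refine h.congr_deriv ?_
    rw [cassiniCoeff_snd_succ, hqr, ← deltaPoly_star, hstar]

lemma sderivQ_spow_even (q0 q : ℍ) (k : ℕ) :
    sderivQ (spow q0 (2 * k)) q = ((cassiniCoeff q0 q k).2 : ℍ) := by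
  have hs : spow q0 (2 * k) = fun p => deltaPoly q0 p ^ k := by
    funext p
    simp [spow]
  rw [hs]
  by_cases hq : q.im = 0
  · rw [sderivQ, if_pos hq, (hasDerivAt_deltaPoly_pow q0 q hq k).deriv]
  · refine sderivQ_of_im_ne_zero _ hq ?_
    simp only [deltaPoly_star, ← star_pow, deltaPoly_pow q0 q]
    ext <;> simp <;> ring

lemma sderivQ_spow_odd (q0 q : ℍ) (k : ℕ) :
    sderivQ (spow q0 (2 * k + 1)) q =
      ((cassiniCoeff q0 q k).1 : ℍ) - q0 * ((cassiniCoeff q0 q k).2 : ℍ) := by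
  have hs : spow q0 (2 * k + 1) = fun p => (p - q0) * deltaPoly q0 p ^ k := by
    funext p
    simp [spow, Nat.add_mod, show (2 * k + 1) / 2 = k by omega]
  rw [hs]
  by_cases hq : q.im = 0
  · have hqr : ((q.re : ℝ) : ℍ) = q := by
      conv_rhs => rw [← Quaternion.re_add_im q, hq, add_zero]
    have hstar : star q = q := by rw [← hqr, Quaternion.star_coe]
    have h := ((hasDerivAt_quaternion_coe q.re).sub_const q0).mul
      (hasDerivAt_deltaPoly_pow q0 q hq k)
    rw [sderivQ, if_pos hq]
    refine h.deriv.trans ?_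
    rw [hqr, deltaPoly_pow, hstar]
    noncomm_ring
  · refine sderivQ_of_im_ne_zero _ hq ?_
    simp only [deltaPoly_star, ← star_pow, deltaPoly_pow q0 q]
    ext <;> simp <;> ring

end Coefficients

section NeumannSeries

variable {R : Type*} [NormedRing R]

lemma norm_mul_pow_le (a b : R) (k : ℕ) : ‖a * b ^ k‖ ≤ ‖a‖ * ‖b‖ ^ k := by
  induction k with
  | zero => simp
  | succ k ih =>
    rw [pow_succ, ← mul_assoc, pow_succ, ← mul_assoc]
    exact (norm_mul_le _ _).trans (by gcongr)

lemma summable_smul_mul_pow [NormedAlgebra ℝ R] [CompleteSpace R] (a b : R) {c : ℕ → ℝ}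
    (hc : Summable fun k => |c k| * ‖b‖ ^ k) : Summable fun k => c k • (a * b ^ k) := by
  refine Summable.of_norm_bounded (hc.mul_left ‖a‖) fun k => ?_
  rw [norm_smul, Real.norm_eq_abs]
  calc _ ≤ |c k| * (‖a‖ * ‖b‖ ^ k) := by gcongr; exact norm_mul_pow_le a b k
    _ = _ := by ring

/-- If `L + L' = s`, then a power series in `b` with coefficients `(c₁ - s c₂) b + c₂ a` is the
sum of the series interleaving `c₂ a b ^ k - c₂ b b ^ k L` and `c₁ b b ^ k - c₂ b b ^ k L'`. -/
lemma hasSum_interleave [NormedAlgebra ℝ R] [CompleteSpace R] {a b L L' S : R} {s : ℝ}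
    {c₁ c₂ : ℕ → ℝ} (hL : L + L' = s • 1) (h₁ : Summable fun k => |c₁ k| * ‖b‖ ^ k)
    (h₂ : Summable fun k => |c₂ k| * ‖b‖ ^ k)
    (hS : HasSum (fun k => ((c₁ k - s * c₂ k) • b + c₂ k • a) * b ^ k) S) {E : ℕ → R}
    (hE₀ : ∀ k, E (2 * k) = c₂ k • (a * b ^ k) - c₂ k • (b * b ^ k) * L)
    (hE₁ : ∀ k, E (2 * k + 1) = c₁ k • (b * b ^ k) - c₂ k • (b * b ^ k) * L') : HasSum E S := by
  obtain ⟨A, hA⟩ := summable_smul_mul_pow b b h₁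
  obtain ⟨B, hB⟩ := summable_smul_mul_pow b b h₂
  obtain ⟨C, hC⟩ := summable_smul_mul_pow a b h₂
  have hS' : (C - B * L) + (A - B * L') = S := by
    have h1 := (hA.sub (hB.const_smul s)).add hC
    have h2 : A - s • B + C = S := by
      refine h1.unique (hS.congr_fun fun k => ?_)
      simp only [add_mul, smul_mul_assoc]
      module
    rw [← h2, show s • B = B * (s • 1) by rw [mul_smul_comm, mul_one], ← hL, mul_add]
    abel
  rw [← hS']
  refine HasSum.even_add_odd ?_ ?_
  · simp only [hE₀]
    exact hC.sub (hB.mul_right _)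
  · simp only [hE₁]
    exact hA.sub (hB.mul_right _)

/-- If `P = A Q` and `Q = Δ_{q0}(A)⁻¹` then `1 - d P - e Q = Δ_q(A) Q` has a two-sided inverse `G`
such that `Q G` is the sum of a power series in `Q`. -/
lemma exists_inverse_hasSum [NormedAlgebra ℝ R] [CompleteSpace R] (q0 q : ℍ) (P Q : R)
    (hPQ : P * Q = Q * P)
    (hP : P * P = Q + (2 * q0.re) • (Q * P) - (‖q0‖ ^ 2) • (Q * Q))
    (hz : ‖deltaPoly q0 q‖ * ‖Q‖ < 1) :
    ∃ G : R,
      (1 - (2 * q.re - 2 * q0.re) • P - (‖q0‖ ^ 2 - ‖q‖ ^ 2) • Q) * G = 1 ∧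
      G * (1 - (2 * q.re - 2 * q0.re) • P - (‖q0‖ ^ 2 - ‖q‖ ^ 2) • Q) = 1 ∧
      HasSum (fun k => (((cassiniCoeff q0 q k).1 - 2 * q0.re * (cassiniCoeff q0 q k).2) • Q +
        (cassiniCoeff q0 q k).2 • P) * Q ^ k) (Q * G) := by
  set W : R := 1 - (2 * q.re - 2 * q0.re) • P - (‖q0‖ ^ 2 - ‖q‖ ^ 2) • Q with hW
  set c := cassiniCoeff q0 q with hc
  have hc0 : c 0 = (1, 0) := rfl
  have hc1 (k : ℕ) : (c (k + 1)).1 =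
      ((2 * q.re - 2 * q0.re) * (2 * q.re) + (‖q0‖ ^ 2 - ‖q‖ ^ 2)) * (c k).1 -
        (2 * q.re - 2 * q0.re) * ‖q‖ ^ 2 * (c k).2 := rfl
  have hc2 (k : ℕ) : (c (k + 1)).2 =
      (2 * q.re - 2 * q0.re) * (c k).1 + (‖q0‖ ^ 2 - ‖q‖ ^ 2) * (c k).2 := rfl
  have hs1 := summable_cassiniCoeff_fst_succ q0 q (norm_nonneg Q) hz
  have hs2 := summable_cassiniCoeff_snd_succ q0 q (norm_nonneg Q) hz
  let h (s : ℝ) (k : ℕ) : R :=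
    (((c (k + 1)).1 - s * (c (k + 1)).2) • Q + (c (k + 1)).2 • P) * Q ^ k
  have hh (s : ℝ) : Summable (h s) := by
    have := ((summable_smul_mul_pow Q Q hs1).sub
      ((summable_smul_mul_pow Q Q hs2).const_smul s)).add (summable_smul_mul_pow P Q hs2)
    refine this.congr fun k => ?_
    simp only [h, add_mul, smul_mul_assoc]
    module
  have hWh (k : ℕ) : W * h (2 * q0.re) k = h (2 * q.re) k - h (2 * q.re) (k + 1) := by
    simp only [h]
    rw [pow_succ', ← mul_assoc, ← mul_assoc, ← sub_mul, hc1 (k + 1), hc2 (k + 1)]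
    congr 1
    simp only [hW, sub_mul, mul_add, add_mul, one_mul, hP, hPQ, smul_mul_assoc,
      mul_smul_comm]
    module
  have hcomm (k : ℕ) : Commute W (h (2 * q0.re) k) := by
    have hP' : Commute W P := ((Commute.one_left P).sub_left
      ((Commute.refl P).smul_left _)).sub_left ((show Commute Q P from hPQ.symm).smul_left _)
    have hQ' : Commute W Q := ((Commute.one_left Q).sub_left
      ((show Commute P Q from hPQ).smul_left _)).sub_left ((Commute.refl Q).smul_left _)
    exact ((hQ'.smul_right _).add_right (hP'.smul_right _)).mul_right (hQ'.pow_right k)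
  obtain ⟨S, hS⟩ := hh (2 * q0.re)
  have hWS : W * S = h (2 * q.re) 0 := by
    have h1 := (hS.mul_left W).tendsto_sum_nat
    simp only [hWh, Finset.sum_range_sub'] at h1
    have h2 := (hh (2 * q.re)).tendsto_atTop_zero.const_sub (h (2 * q.re) 0)
    rw [sub_zero] at h2
    exact tendsto_nhds_unique h1 h2
  have hSW : S * W = W * S :=
    (hS.mul_right W).unique (by simpa only [(hcomm _).eq] using hS.mul_left W)
  have hone : W + h (2 * q.re) 0 = 1 := by
    simp only [h, hc1, hc2, hc0, hW]
    rw [pow_zero, mul_one]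
    module
  refine ⟨1 + S, by rw [mul_add, mul_one, hWS, hone], by rw [add_mul, one_mul, hSW, hWS, hone], ?_⟩
  rw [← hasSum_nat_add_iff' 1]
  have h0 : Q * (1 + S) - ∑ i ∈ Finset.range 1,
      (((c i).1 - 2 * q0.re * (c i).2) • Q + (c i).2 • P) * Q ^ i = Q * S := by
    simp [hc0, mul_add]
  rw [h0]
  refine (hS.mul_left Q).congr_fun fun k => ?_
  simp only [h]
  rw [pow_succ', ← mul_assoc, ← mul_assoc]
  congr 1
  simp only [mul_add, add_mul, mul_smul_comm, smul_mul_assoc, hPQ]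

end NeumannSeries
section Operators

variable {X : Type*} [NormedAddCommGroup X] [Module ℍ X] [Module ℍᵐᵒᵖ X]

namespace RightLinearOp

variable (T : RightLinearOp X)

lemma sub_mem {x y : X} (hx : x ∈ T.dom) (hy : y ∈ T.dom) : x - y ∈ T.dom := by
  rw [sub_eq_add_neg]
  exact T.add_mem hx (T.neg_mem hy)

lemma map_sub {x y : X} (hx : x ∈ T.dom) (hy : y ∈ T.dom) :
    T.toFun (x - y) = T.toFun x - T.toFun y := by
  rw [eq_sub_iff_add_eq, ← T.map_add' (T.sub_mem hx hy) hy, sub_add_cancel]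

lemma isQInv_qres {q : ℍ} (hq : q ∈ T.rhoS) : T.IsQInv q (T.qres q) := by
  rw [qres, dif_pos hq]
  exact Exists.choose_spec hq

lemma Bop_even (q0 : ℍ) (k : ℕ) (x : X) :
    T.Bop q0 (2 * k) x = (T.qres q0)^[k] x := by
  simp [Bop]

lemma Bop_odd (q0 : ℍ) (k : ℕ) (x : X) :
    T.Bop q0 (2 * k + 1) x = (T.qres q0)^[k] (T.sres q0 x) := by
  simp [Bop, Nat.add_mod, show (2 * k + 1) / 2 = k by omega]

variable {T}

lemma IsQInv.eq {q : ℍ} {B C : X → X} (hB : T.IsQInv q B) (hC : T.IsQInv q C) : B = C := by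
  funext x
  rw [← hC.2.2.2 _ (hB.2.1 x), hB.2.2.1]

end RightLinearOp

/-- The real normed space underlying a two-sided quaternionic module. -/
noncomputable abbrev QuatBimodule.toNormedSpace [QuatBimodule X] : NormedSpace ℝ X :=
  { Module.compHom X (algebraMap ℝ ℍ) with
    norm_smul_le := fun r x => by
      refine (QuatBimodule.norm_smul_left (algebraMap ℝ ℍ r) x).trans_le ?_
      rw [norm_algebraMap'] }

attribute [local instance] QuatBimodule.toNormedSpace

variable [QuatBimodule X]

lemma coe_smul_eq_real_smul (r : ℝ) (x : X) : (r : ℍ) • x = r • x := rfl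

lemma op_coe_smul_eq_real_smul (r : ℝ) (x : X) : op (r : ℍ) • x = r • x :=
  (QuatBimodule.real_smul_comm r x).symm

lemma op_smul_real_smul (q : ℍ) (r : ℝ) (x : X) : op q • (r • x) = r • (op q • x) :=
  (QuatBimodule.smul_op_comm (r : ℍ) q x).symm

/-- Left multiplication by a quaternion as a continuous real linear map. -/
noncomputable def quatSMul (q : ℍ) : X →L[ℝ] X :=
  LinearMap.mkContinuous
    { toFun := fun x => q • x
      map_add' := smul_add q
      map_smul' := fun r x => by
        rw [RingHom.id_apply, ← coe_smul_eq_real_smul, ← coe_smul_eq_real_smul, smul_smul,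
          smul_smul, Quaternion.coe_commutes] }
    ‖q‖ fun x => (QuatBimodule.norm_smul_left q x).le

lemma quatSMul_apply (q : ℍ) (x : X) : quatSMul q x = q • x := rfl

lemma opNorm_coe (B : X →L[ℝ] X) : opNorm (B : X → X) = ‖B‖ := by
  rw [← B.sSup_unitClosedBall_eq_norm, opNorm]
  congr 2
  ext x
  simp

lemma memLinR_coe (B : X →L[ℝ] X) (h : ∀ (q : ℍ) (x : X), B (op q • x) = op q • B x) :
    MemLinR (B : X → X) := by
  refine ⟨B.map_add, h, ‖B‖, ?_⟩
  rintro _ ⟨x, hx, rfl⟩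
  exact B.unit_le_opNorm x hx

lemma MemLinR.exists_continuousLinearMap {B : X → X} (hB : MemLinR B) :
    ∃ L : X →L[ℝ] X, ⇑L = B := by
  obtain ⟨hadd, hsmul, C, hC⟩ := hB
  let f : X →ₗ[ℝ] X :=
    { toFun := B
      map_add' := hadd
      map_smul' := fun r x => by
        rw [← op_coe_smul_eq_real_smul, hsmul, op_coe_smul_eq_real_smul, RingHom.id_apply] }
  obtain ⟨D, hD⟩ := f.bound_of_ball_bound one_pos C fun x hx =>
    hC ⟨x, by simpa using (mem_ball_zero_iff.mp hx).le, rfl⟩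
  exact ⟨f.mkContinuous D hD, rfl⟩

namespace RightLinearOp

variable (T : RightLinearOp X)

lemma smul_mem (r : ℝ) {x : X} (hx : x ∈ T.dom) : r • x ∈ T.dom := by
  rw [← op_coe_smul_eq_real_smul]
  exact T.smulR_mem _ hx

lemma map_smul (r : ℝ) {x : X} (hx : x ∈ T.dom) : T.toFun (r • x) = r • T.toFun x := by
  rw [← op_coe_smul_eq_real_smul, T.map_smulR' _ hx, op_coe_smul_eq_real_smul]

lemma delta_eq (q : ℍ) (x : X) :
    T.delta q x = T.toFun (T.toFun x) - (2 * q.re) • T.toFun x + (‖q‖ ^ 2) • x := rfl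

variable {T}

/-- For a closed operator, `A Q_q(A)` is bounded, by the closed graph theorem. -/
lemma IsQInv.exists_toFun_comp [CompleteSpace X] (hT : T.IsClosedOp) {q : ℍ} {Q : X →L[ℝ] X}
    (hQ : T.IsQInv q Q) : ∃ P : X →L[ℝ] X, ∀ x, P x = T.toFun (Q x) := by
  have hdom (x : X) : Q x ∈ T.dom := (hQ.2.1 x).1
  let f : X →ₗ[ℝ] X :=
    { toFun := fun x => T.toFun (Q x)
      map_add' := fun x y => by rw [map_add, T.map_add' (hdom x) (hdom y)]
      map_smul' := fun r x => by
        rw [ContinuousLinearMap.map_smul, T.map_smul r (hdom x), RingHom.id_apply] }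
  have hf : IsClosed (f.graph : Set (X × X)) := by
    have hc : Continuous fun p : X × X => (Q p.1, p.2) := by fun_prop
    convert hT.preimage hc using 1
    ext p
    simp [f, hdom, eq_comm]
  exact ⟨ContinuousLinearMap.ofIsClosedGraph hf, fun x => rfl⟩

/-- `A` commutes with `Q_q(A)` on the domain of `A`. -/
lemma IsQInv.toFun_comm {q : ℍ} {Q : X → X} (hQ : T.IsQInv q Q) {x : X} (hx : x ∈ T.dom) :
    T.toFun (Q x) = Q (T.toFun x) := by
  obtain ⟨h1, h2⟩ := hQ.2.1 x
  have hd := hQ.2.2.1 x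
  rw [delta_eq] at hd
  have hsq : T.toFun (T.toFun (Q x)) =
      x + (2 * q.re) • T.toFun (Q x) - (‖q‖ ^ 2) • Q x := by
    nth_rw 2 [← hd]
    abel
  have h3 : T.toFun (T.toFun (Q x)) ∈ T.dom := by
    rw [hsq]
    exact T.sub_mem (T.add_mem hx (T.smul_mem _ h2)) (T.smul_mem _ h1)
  rw [← hQ.2.2.2 _ ⟨h2, h3⟩, delta_eq]
  congr 1
  rw [hsq, T.map_sub (T.add_mem hx (T.smul_mem _ h2)) (T.smul_mem _ h1),
    T.map_add' hx (T.smul_mem _ h2), T.map_smul _ h2, T.map_smul _ h1, hsq]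
  abel

/-- The terms of the series are continuous real linear operators; consecutive ones add up to the
terms of the series in `exists_inverse_hasSum`. -/
lemma exists_hasSum_series [CompleteSpace X] (q0 q : ℍ)
    {P Q S : X →L[ℝ] X} (hQ : ⇑Q = T.qres q0) (hP : ∀ x, P x = T.toFun (Q x)) (hPQ : P * Q = Q * P)
    (hz : ‖deltaPoly q0 q‖ * ‖Q‖ < 1)
    (hS : HasSum (fun k => (((cassiniCoeff q0 q k).1 - 2 * q0.re * (cassiniCoeff q0 q k).2) • Q +
        (cassiniCoeff q0 q k).2 • P) * Q ^ k) S) :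
    ∃ E : ℕ → X →L[ℝ] X, HasSum E S ∧ ∀ n x,
      E n x = T.Bop q0 (n + 1) ((((-1 : ℍ) ^ (n + 1)) * sderivQ (spow q0 n) q) • x) := by
  have hs1 : Summable fun k => |(cassiniCoeff q0 q k).1| * ‖Q‖ ^ k :=
    Summable.mul_pow_of_succ (c := fun k => |(cassiniCoeff q0 q k).1|)
      (summable_cassiniCoeff_fst_succ q0 q (norm_nonneg Q) hz)
  have hs2 : Summable fun k => |(cassiniCoeff q0 q k).2| * ‖Q‖ ^ k :=
    Summable.mul_pow_of_succ (c := fun k => |(cassiniCoeff q0 q k).2|)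
      (summable_cassiniCoeff_snd_succ q0 q (norm_nonneg Q) hz)
  have hL : (quatSMul (star q0) + quatSMul q0 : X →L[ℝ] X) = (2 * q0.re) • 1 := by
    ext x
    rw [add_apply, quatSMul_apply, quatSMul_apply, ← add_smul, Quaternion.star_add_self']
    rfl
  have hiter (k : ℕ) (x : X) : (T.qres q0)^[k] x = (Q ^ k) x := by
    rw [← hQ, FunLike.coe_pow_eq_iterate]
  let c := cassiniCoeff q0 q
  let e (k : ℕ) : X →L[ℝ] X :=
    (c k).2 • (P * Q ^ k) - (c k).2 • (Q * Q ^ k) * quatSMul (star q0)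
  let o (k : ℕ) : X →L[ℝ] X := (c k).1 • (Q * Q ^ k) - (c k).2 • (Q * Q ^ k) * quatSMul q0
  let E (n : ℕ) : X →L[ℝ] X := if n % 2 = 0 then e (n / 2) else o (n / 2)
  have hEe (k : ℕ) : E (2 * k) = e k := by simp [E]
  have hEo (k : ℕ) : E (2 * k + 1) = o k := by
    simp [E, Nat.add_mod, show (2 * k + 1) / 2 = k by omega]
  refine ⟨E, hasSum_interleave hL hs1 hs2 hS hEe hEo, fun n x => ?_⟩
  · obtain ⟨k, rfl | rfl⟩ := n.even_or_odd'
    · have hy : (((-1 : ℍ) ^ (2 * k + 1)) * ((c k).2 : ℍ)) • x = (-(c k).2) • x := by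
        rw [pow_succ, pow_mul, neg_one_sq, one_pow, one_mul, neg_one_mul, ← Quaternion.coe_neg,
          coe_smul_eq_real_smul]
      have he : e k = (-(c k).2) • (Q ^ k * (Q * quatSMul (star q0) - P)) := by
        have h : Q ^ k * P = P * Q ^ k := ((show Commute Q P from hPQ.symm).pow_left k).eq
        rw [mul_sub, h, ← mul_assoc, ← pow_succ, pow_succ']
        simp only [e, smul_mul_assoc]
        module
      rw [hEe, sderivQ_spow_even, Bop_odd, hy, hiter, sres, ← hQ, ← hP, ← quatSMul_apply, he]
      simp only [smul_apply, mul_apply_eq_comp, sub_apply, ContinuousLinearMap.map_smul,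
        _root_.map_sub, smul_sub]
    · have hy : (((-1 : ℍ) ^ (2 * k + 1 + 1)) * (((c k).1 : ℍ) - q0 * ((c k).2 : ℍ))) • x =
          (c k).1 • x - quatSMul q0 ((c k).2 • x) := by
        rw [show 2 * k + 1 + 1 = 2 * (k + 1) by ring, pow_mul, neg_one_sq, one_pow, one_mul,
          sub_smul, mul_smul]
        rfl
      rw [hEo, sderivQ_spow_odd, hy, show 2 * k + 1 + 1 = 2 * (k + 1) by ring, Bop_even, hiter,
        pow_succ']
      simp only [o, smul_apply, mul_apply_eq_comp, sub_apply, ContinuousLinearMap.map_smul,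
        _root_.map_sub]

end RightLinearOp

end Operators

/-- Corollary `cor3`, first part: for every `q` in the Cassini
ball `U(q0, ‖Q_{q0}(A)‖^{-1/2})` (which is contained in `ρ_S(A)`), the series
`Σ_{n=0}^∞ (−1)^{n+1} B_{n+1} ∂_S p_{q0,n}(q)` converges in `Lin^r(X)` (i.e. in
the operator norm) and its sum is `Q_q(A)`. -/
theorem stmt4 {X : Type*} [NormedAddCommGroup X] [CompleteSpace X]
    [Module ℍ X] [Module ℍᵐᵒᵖ X] [QuatBimodule X]
    (T : RightLinearOp X) (hT : T.IsClosedOp)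
    (hreal : ∃ r : ℝ, ((r : ℝ) : ℍ) ∈ T.rhoS)
    (q0 : ℍ) (hq0 : q0 ∈ T.rhoS) :
    ∀ q ∈ cassiniBall q0 (Real.sqrt (opNorm (T.qres q0)))⁻¹,
      q ∈ T.rhoS ∧
      Tendsto (fun N : ℕ => opNorm (fun x : X =>
          (∑ n ∈ Finset.range N,
            T.Bop q0 (n + 1) ((((-1 : ℍ) ^ (n + 1)) * sderivQ (spow q0 n) q) • x))
          - T.qres q x))
        atTop (𝓝 0) := by
  let _ : NormedSpace ℝ X := QuatBimodule.toNormedSpace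
  intro q hq
  have hQ0 := T.isQInv_qres hq0
  obtain ⟨Q, hQ⟩ := hQ0.1.exists_continuousLinearMap
  rw [← hQ] at hQ0
  obtain ⟨P, hP⟩ := hQ0.exists_toFun_comp hT
  have hdom (x : X) : Q x ∈ T.dom := (hQ0.2.1 x).1
  have hPQ : P * Q = Q * P := by
    ext x
    simp only [mul_apply_eq_comp, hP]
    exact hQ0.toFun_comm (hdom x)
  have hA2 (x : X) : T.toFun (P x) = x + (2 * q0.re) • P x - (‖q0‖ ^ 2) • Q x := by
    have hd := hQ0.2.2.1 x
    rw [RightLinearOp.delta_eq, ← hP] at hd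
    nth_rw 2 [← hd]
    abel
  have hPP : P * P = Q + (2 * q0.re) • (Q * P) - (‖q0‖ ^ 2) • (Q * Q) := by
    ext x
    have h := hQ0.toFun_comm (x := P x) (by rw [hP]; exact (hQ0.2.1 x).2)
    simp only [mul_apply_eq_comp, hP (P x), h, hA2, map_sub, map_add,
      ContinuousLinearMap.map_smul, add_apply, sub_apply,
      smul_apply]
  have hz : ‖deltaPoly q0 q‖ * ‖Q‖ < 1 := by
    have h : √‖deltaPoly q0 q‖ < (√‖Q‖)⁻¹ := by
      rw [← opNorm_coe, hQ]
      exact hq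
    have hpos : 0 < √‖Q‖ := inv_pos.mp ((Real.sqrt_nonneg _).trans_lt h)
    have h' := mul_lt_mul_of_pos_right h hpos
    rwa [inv_mul_cancel₀ hpos.ne', ← Real.sqrt_mul (norm_nonneg _), Real.sqrt_lt' one_pos,
      one_pow] at h'
  obtain ⟨G, hWG, hGW, hS⟩ := exists_inverse_hasSum q0 q P Q hPQ hPP hz
  have hdelta (x : X) : T.delta q (Q x) =
      (1 - (2 * q.re - 2 * q0.re) • P - (‖q0‖ ^ 2 - ‖q‖ ^ 2) • Q : X →L[ℝ] X) x := by
    rw [RightLinearOp.delta_eq, ← hP, hA2]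
    simp only [sub_apply, smul_apply,
      one_apply_eq_self]
    module
  have hPop (p : ℍ) (x : X) : P (op p • x) = op p • P x := by
    rw [hP, hQ0.1.2.1, T.map_smulR' _ (hdom x), hP]
  have hGop (p : ℍ) (x : X) : G (op p • x) = op p • G x := by
    have hW (y : X) : (1 - (2 * q.re - 2 * q0.re) • P - (‖q0‖ ^ 2 - ‖q‖ ^ 2) • Q : X →L[ℝ] X)
        (op p • y) = op p • (1 - (2 * q.re - 2 * q0.re) • P -
          (‖q0‖ ^ 2 - ‖q‖ ^ 2) • Q : X →L[ℝ] X) y := by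
      simp only [sub_apply, smul_apply,
        one_apply_eq_self, smul_sub, op_smul_real_smul, hPop, hQ0.1.2.1]
    generalize (1 - (2 * q.re - 2 * q0.re) • P - (‖q0‖ ^ 2 - ‖q‖ ^ 2) • Q : X →L[ℝ] X) = W at *
    have h := hW (G x)
    rw [← mul_apply_eq_comp W G, hWG, one_apply_eq_self] at h
    rw [← h, ← mul_apply_eq_comp G W, hGW, one_apply_eq_self]
  have hinv : T.IsQInv q (Q * G : X →L[ℝ] X) := by
    refine ⟨memLinR_coe _ fun p x => ?_, fun x => hQ0.2.1 (G x), fun x => ?_, fun x hx => ?_⟩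
    · rw [mul_apply_eq_comp, hGop, hQ0.1.2.1, mul_apply_eq_comp]
    · rw [mul_apply_eq_comp, hdelta, ← mul_apply_eq_comp, hWG,
        one_apply_eq_self]
    · conv_lhs => rw [← hQ0.2.2.2 x hx, hdelta]
      rw [mul_apply_eq_comp, ← mul_apply_eq_comp G, hGW,
        one_apply_eq_self, hQ0.2.2.2 x hx]
  have hmem : q ∈ T.rhoS := ⟨_, hinv⟩
  refine ⟨hmem, ?_⟩
  obtain ⟨E, hE, hEapply⟩ := RightLinearOp.exists_hasSum_series q0 q hQ hP hPQ hz hS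
  have hlim := tendsto_iff_norm_sub_tendsto_zero.mp hE.tendsto_sum_nat
  refine hlim.congr fun N => ?_
  rw [← opNorm_coe, (T.isQInv_qres hmem).eq hinv]
  congr 1
  funext x
  simp only [sub_apply, sum_apply, hEapply]
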